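/- Let G be a finite simple graph. Then α(G) − |α_core(G)| ≤ τ(G) − |τ_core(G)|. -/

import Mathlib

/-- A set of vertices is stable (independent) if no two of its vertices are adjacent. -/
def IsStable {V : Type*} (G : SimpleGraph V) (S : Set V) : Prop :=
  ∀ ⦃u⦄, u ∈ S → ∀ ⦃v⦄, v ∈ S → ¬ G.Adj u v

/-- A set of vertices is a vertex cover if it meets every edge. -/
def IsCover {V : Type*} (G : SimpleGraph V) (C : Set V) : Prop :=
  ∀ ⦃u v⦄, G.Adj u v → u ∈ C ∨ v ∈ C

/-- The stability number α(G): the maximum size of a stable set. -/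
noncomputable def alphaNum {V : Type*} (G : SimpleGraph V) : ℕ :=
  sSup {n | ∃ S : Set V, IsStable G S ∧ S.ncard = n}

/-- The vertex covering number τ(G): the minimum size of a vertex cover. -/
noncomputable def tauNum {V : Type*} (G : SimpleGraph V) : ℕ :=
  sInf {n | ∃ C : Set V, IsCover G C ∧ C.ncard = n}

/-- An inclusionwise maximal stable set. -/
def IsMaximalStable {V : Type*} (G : SimpleGraph V) (S : Set V) : Prop :=
  IsStable G S ∧ ∀ T : Set V, IsStable G T → S ⊆ T → S = T

/-- The σ_v-cover number: the maximum m such that every vertex belongs to a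
maximal stable set with at least m vertices. -/
noncomputable def sigmaV {V : Type*} (G : SimpleGraph V) : ℕ :=
  sSup {m | ∀ v : V, ∃ S : Set V, v ∈ S ∧ IsMaximalStable G S ∧ m ≤ S.ncard}

/-- α_core(G): the intersection of all maximum stable sets of G. -/
def alphaCore {V : Type*} (G : SimpleGraph V) : Set V :=
  {v | ∀ S : Set V, IsStable G S → S.ncard = alphaNum G → v ∈ S}

/-- τ_core(G): the intersection of all minimum vertex covers of G. -/
def tauCore {V : Type*} (G : SimpleGraph V) : Set V :=
  {v | ∀ C : Set V, IsCover G C → C.ncard = tauNum G → v ∈ C}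

section StableSets

variable {V : Type*} {G : SimpleGraph V}

theorem isCover_compl_iff {S : Set V} : IsCover G Sᶜ ↔ IsStable G S := by
  simp only [IsCover, IsStable, Set.mem_compl_iff]
  grind

theorem bddAbove_stable_ncard [Finite V] (G : SimpleGraph V) :
    BddAbove {n | ∃ S : Set V, IsStable G S ∧ S.ncard = n} :=
  ⟨Nat.card V, by rintro _ ⟨S, -, rfl⟩; exact Set.ncard_le_card S⟩

theorem IsStable.ncard_le_alphaNum [Finite V] {S : Set V} (hS : IsStable G S) :
    S.ncard ≤ alphaNum G :=
  le_csSup (bddAbove_stable_ncard G) ⟨S, hS, rfl⟩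

theorem exists_isStable_ncard_eq_alphaNum [Finite V] (G : SimpleGraph V) :
    ∃ S : Set V, IsStable G S ∧ S.ncard = alphaNum G :=
  Nat.sSup_mem (s := {n | ∃ S : Set V, IsStable G S ∧ S.ncard = n})
    ⟨0, ∅, by simp [IsStable], by simp⟩ (bddAbove_stable_ncard G)

theorem IsCover.tauNum_le_ncard {C : Set V} (hC : IsCover G C) : tauNum G ≤ C.ncard :=
  Nat.sInf_le ⟨C, hC, rfl⟩

theorem exists_isCover_ncard_eq_tauNum (G : SimpleGraph V) :
    ∃ C : Set V, IsCover G C ∧ C.ncard = tauNum G :=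
  Nat.sInf_mem (s := {n | ∃ C : Set V, IsCover G C ∧ C.ncard = n})
    ⟨_, Set.univ, fun _ _ _ => Or.inl trivial, rfl⟩

/-- Gallai's identity. -/
theorem alphaNum_add_tauNum [Finite V] (G : SimpleGraph V) :
    alphaNum G + tauNum G = Nat.card V := by
  obtain ⟨S, hS, hSα⟩ := exists_isStable_ncard_eq_alphaNum G
  obtain ⟨C, hC, hCτ⟩ := exists_isCover_ncard_eq_tauNum G
  have hτ := (isCover_compl_iff.2 hS).tauNum_le_ncard
  have hα := (isCover_compl_iff.1 ((compl_compl C).symm ▸ hC)).ncard_le_alphaNum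
  have := Set.ncard_add_ncard_compl S
  have := Set.ncard_add_ncard_compl C
  omega

/-- The family of maximum stable sets. -/
def maxStableSets (G : SimpleGraph V) : Set (Set V) :=
  {S | IsStable G S ∧ S.ncard = alphaNum G}

theorem alphaCore_eq_sInter (G : SimpleGraph V) :
    alphaCore G = ⋂₀ maxStableSets G := by
  ext v
  simp [alphaCore, maxStableSets]

theorem compl_tauCore_eq_sUnion [Finite V] (G : SimpleGraph V) :
    (tauCore G)ᶜ = ⋃₀ maxStableSets G := by
  have hG := alphaNum_add_tauNum G
  ext v
  simp only [tauCore, maxStableSets, Set.mem_compl_iff, Set.mem_ofPred_eq, Set.mem_sUnion]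
  push Not
  constructor
  · rintro ⟨C, hC, hCτ, hv⟩
    have := Set.ncard_add_ncard_compl C
    exact ⟨Cᶜ, ⟨isCover_compl_iff.1 ((compl_compl C).symm ▸ hC), by omega⟩, hv⟩
  · rintro ⟨S, ⟨hS, hSα⟩, hv⟩
    have := Set.ncard_add_ncard_compl S
    exact ⟨Sᶜ, isCover_compl_iff.2 hS, by omega, fun h => h hv⟩

/-- If no vertex of `I ⊆ U` is adjacent to a vertex of `U`, then passing to `I ∩ S` and `U ∪ S`
for a maximum stable set `S` does not decrease the sum of the sizes. -/
theorem ncard_add_ncard_le_inter_union [Finite V] {I U S : Set V} (hIU : I ⊆ U)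
    (hadj : ∀ u ∈ I, ∀ v ∈ U, ¬ G.Adj u v) (hS : S ∈ maxStableSets G) :
    I.ncard + U.ncard ≤ (I ∩ S).ncard + (U ∪ S).ncard := by
  have hT : IsStable G (S ∩ U ∪ I \ S) := by
    rintro u (hu | hu) v (hv | hv) h
    · exact hS.1 hu.1 hv.1 h
    · exact hadj v hv.1 u hu.2 h.symm
    · exact hadj u hu.1 v hv.2 h
    · exact hadj u hu.1 v (hIU hv.1) h
  have hle := hT.ncard_le_alphaNum
  rw [Set.ncard_union_eq (Set.disjoint_left.2 fun _ hx hx' => hx'.2 hx.1), ← hS.2] at hle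
  have := Set.ncard_inter_add_ncard_sdiff_eq_ncard I S
  have := Set.ncard_union_add_ncard_inter U S
  rw [Set.inter_comm U S] at this
  omega

theorem two_mul_alphaNum_le_sInter_add_sUnion [Finite V] {Γ : Set (Set V)}
    (hΓ : Γ ⊆ maxStableSets G) (hne : Γ.Nonempty) :
    2 * alphaNum G ≤ (⋂₀ Γ).ncard + (⋃₀ Γ).ncard := by
  induction Γ, Γ.toFinite using Set.Finite.induction_on with
  | empty => simp at hne
  | @insert S Γ _ _ ih =>
    have hS := hΓ (Set.mem_insert S Γ)
    have hΓ' := (Set.subset_insert S Γ).trans hΓ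
    rcases Γ.eq_empty_or_nonempty with rfl | hne'
    · simp [hS.2, two_mul]
    · rw [Set.sInter_insert, Set.sUnion_insert, Set.inter_comm, Set.union_comm]
      refine (ih hΓ' hne').trans (ncard_add_ncard_le_inter_union ?_ ?_ hS)
      · obtain ⟨T, hT⟩ := hne'
        exact (Set.sInter_subset_of_mem hT).trans (Set.subset_sUnion_of_mem hT)
      · rintro u hu v ⟨T, hT, hv⟩
        exact (hΓ' hT).1 (hu T hT) hv

end StableSets

/-- α(G) − |α_core(G)| ≤ τ(G) − |τ_core(G)|. -/
theorem stmt_6 {V : Type*} [Fintype V] (G : SimpleGraph V) :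
    alphaNum G - (alphaCore G).ncard ≤ tauNum G - (tauCore G).ncard := by
  have hG := alphaNum_add_tauNum G
  have h := two_mul_alphaNum_le_sInter_add_sUnion (subset_refl (maxStableSets G))
    (exists_isStable_ncard_eq_alphaNum G)
  rw [← alphaCore_eq_sInter, ← compl_tauCore_eq_sUnion] at h
  have := Set.ncard_add_ncard_compl (tauCore G)
  omega
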